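/- arXiv:2206.10091 — 3 statements merged into one kernel-verified Lean document; each statement's English description precedes it below -/
import Mathlib

section
/- Let g and g* be dual finite-dimensional vector spaces, τ = Σᵢ τ_{i1}∧τ_{i2}∧τ_{i3} ∈ ∧³g and φ = Σⱼ φ_{j1}∧φ_{j2}∧φ_{j3} ∈ ∧³g*. Define operators Q₁ on g and Q₃ on g* by Q₁(x) = ι_{ι_xφ}τ and Q₃(ξ) = ι_{ι_ξτ}φ. Then for all x ∈ g and ξ ∈ g*: ⟨Q₁(x)|ξ⟩ + ⟨x|Q₃(ξ)⟩ = 2⟨ι_xφ | ι_ξτ⟩. -/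
set_option synthInstance.maxHeartbeats 1000000
set_option maxHeartbeats 1000000

noncomputable section

open ExteriorAlgebra Module MulOpposite

variable {R : Type*} {M W : Type*} [CommRing R] [AddCommGroup M] [Module R M]
  [AddCommGroup W] [Module R W]

/-- Contraction of a multivector by a single covector. -/
def ctr (ξ : Module.Dual R M) : ExteriorAlgebra R M →ₗ[R] ExteriorAlgebra R M :=
  CliffordAlgebra.contractLeft ξ

/-- Contraction of elements of `⋀ M` by multivectors built on `W`, where vectors of `W`
act through the pairing `p`.  This is an algebra morphism into the opposite endomorphism
algebra, so that `ι_{w₁ ∧ w₂} = ι_{w₂} ∘ ι_{w₁}`. -/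
def mctrAux (p : W →ₗ[R] Module.Dual R M) :
    ExteriorAlgebra R W →ₐ[R] (Module.End R (ExteriorAlgebra R M))ᵐᵒᵖ :=
  ExteriorAlgebra.lift R ⟨((MulOpposite.opLinearEquiv R).toLinearMap.comp
      ((CliffordAlgebra.contractLeft (Q := (0 : QuadraticForm R M))).comp p)), fun w => by
    apply MulOpposite.unop_injective
    apply LinearMap.ext
    intro x
    simpa using CliffordAlgebra.contractLeft_contractLeft (d := p w) (x := x)⟩

variable (R M)

/-- Contraction of multivectors by exterior forms. -/
def mctrF : ExteriorAlgebra R (Module.Dual R M) →ₐ[R]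
    (Module.End R (ExteriorAlgebra R M))ᵐᵒᵖ :=
  mctrAux (LinearMap.id)

/-- Contraction of exterior forms by multivectors. -/
def mctrV : ExteriorAlgebra R M →ₐ[R]
    (Module.End R (ExteriorAlgebra R (Module.Dual R M)))ᵐᵒᵖ :=
  mctrAux (Module.Dual.eval R M)

variable {R M}

/-- The full pairing `⟨ω | r⟩` of an exterior form against a multivector, given by the
scalar part of the full contraction of `r` by `ω`. -/
def epair (ω : ExteriorAlgebra R (Module.Dual R M)) (r : ExteriorAlgebra R M) : R :=
  algebraMapInv ((mctrF R M ω).unop r)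

/-- Contraction of forms by a single vector. -/
def ctrv (x : M) : ExteriorAlgebra R (Module.Dual R M) →ₗ[R]
    ExteriorAlgebra R (Module.Dual R M) :=
  CliffordAlgebra.contractLeft (Module.Dual.eval R M x)


open ExteriorAlgebra Module in
/-- Let `g` and `g*` be dual finite-dimensional vector spaces,
`τ ∈ ∧³g` and `φ ∈ ∧³g*`.  Define `Q₁` on `g` and `Q₃` on `g*` by
`Q₁(x) = ι_{ι_xφ}τ` and `Q₃(ξ) = ι_{ι_ξτ}φ`.  Then for all `x ∈ g` and `ξ ∈ g*`:
`⟨Q₁(x)|ξ⟩ + ⟨x|Q₃(ξ)⟩ = 2⟨ι_xφ | ι_ξτ⟩`. -/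
theorem Q1_Q3_pairing
    (g : Type*) [AddCommGroup g] [Module ℝ g] [FiniteDimensional ℝ g]
    (τ : ExteriorAlgebra ℝ g) (hτ : τ ∈ ⋀[ℝ]^3 g)
    (φ : ExteriorAlgebra ℝ (Module.Dual ℝ g)) (hφ : φ ∈ ⋀[ℝ]^3 (Module.Dual ℝ g))
    (x : g) (ξ : Module.Dual ℝ g) :
    epair (ι ℝ ξ) ((mctrF ℝ g (ctrv x φ)).unop τ)
      + epair ((mctrV ℝ g (ctr ξ τ)).unop φ) (ι ℝ x)
      = 2 * epair (ctrv x φ) (ctr ξ τ) := by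
  have key : ∀ (y : Fin 3 → g) (ψ : Fin 3 → Module.Dual ℝ g),
      epair (ι ℝ ξ) ((mctrF ℝ g (ctrv x (ιMulti ℝ 3 ψ))).unop (ιMulti ℝ 3 y))
      + epair ((mctrV ℝ g (ctr ξ (ιMulti ℝ 3 y))).unop (ιMulti ℝ 3 ψ)) (ι ℝ x)
      = 2 * epair (ctrv x (ιMulti ℝ 3 ψ)) (ctr ξ (ιMulti ℝ 3 y)) := by
    intro y ψ
    have e1 : (ιMulti ℝ 3 y) = ι ℝ (y 0) * (ι ℝ (y 1) * ι ℝ (y 2)) := by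
      simp [ιMulti_apply]
      rfl
    have e2 : (ιMulti ℝ 3 ψ) = ι ℝ (ψ 0) * (ι ℝ (ψ 1) * ι ℝ (ψ 2)) := by
      simp [ιMulti_apply]
      rfl
    rw [e1, e2]
    have cm : ∀ (d : Module.Dual ℝ g) (a : g) (b : ExteriorAlgebra ℝ g),
        ctr d (ι ℝ a * b) = d a • b - ι ℝ a * ctr d b :=
      fun d a b => CliffordAlgebra.contractLeft_ι_mul (Q := 0) (d := d) a b
    have ci : ∀ (d : Module.Dual ℝ g) (a : g),
        ctr d (ι ℝ a) = algebraMap ℝ _ (d a) :=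
      fun d a => CliffordAlgebra.contractLeft_ι (Q := 0) (d := d) a
    have c1 : ∀ (d : Module.Dual ℝ g) (r : ℝ), ctr d (algebraMap ℝ _ r) = 0 :=
      fun d r => CliffordAlgebra.contractLeft_algebraMap (Q := 0) (d := d) r
    have vm : ∀ (d : g) (a : Module.Dual ℝ g) (b : ExteriorAlgebra ℝ (Module.Dual ℝ g)),
        ctrv d (ι ℝ a * b) = a d • b - ι ℝ a * ctrv d b :=
      fun d a b => CliffordAlgebra.contractLeft_ι_mul (Q := 0) (d := Dual.eval ℝ g d) a b
    have vi : ∀ (d : g) (a : Module.Dual ℝ g),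
        ctrv d (ι ℝ a) = algebraMap ℝ _ (a d) :=
      fun d a => CliffordAlgebra.contractLeft_ι (Q := 0) (d := Dual.eval ℝ g d) a
    have v1 : ∀ (d : g) (r : ℝ), ctrv d (algebraMap ℝ _ r) = 0 :=
      fun d r => CliffordAlgebra.contractLeft_algebraMap (Q := 0) (d := Dual.eval ℝ g d) r
    have mF : ∀ (d : Module.Dual ℝ g), mctrF ℝ g (ι ℝ d) = op (ctr d) :=
      fun d => ExteriorAlgebra.lift_ι_apply ℝ _ _ d
    have mV : ∀ (d : g), mctrV ℝ g (ι ℝ d) = op (ctrv d) :=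
      fun d => ExteriorAlgebra.lift_ι_apply ℝ _ _ d
    have ai : ∀ a : g, algebraMapInv (R := ℝ) (ι ℝ a) = 0 := fun a => by
      simp [algebraMapInv]
    have aa : ∀ r : ℝ, algebraMapInv (R := ℝ) (M := g) (algebraMap ℝ _ r) = r :=
      fun r => algebraMap_leftInverse (R := ℝ) g r
    simp only [epair, cm, ci, c1, vm, vi, v1, mF, mV, Algebra.algebraMap_eq_smul_one, map_add,
      map_sub, map_mul, map_smul, map_one, map_zero, mul_sub, sub_mul, mul_smul_comm,
      smul_mul_assoc, mul_one, unop_sub, unop_smul, unop_mul, unop_op, unop_one, unop_zero,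
      LinearMap.sub_apply, LinearMap.smul_apply, Module.End.mul_apply, Module.End.one_apply,
      mul_zero, sub_zero, smul_sub, smul_smul, ai, smul_eq_mul, smul_zero]
    ring
  rw [← ιMulti_span_fixedDegree] at hτ hφ
  induction hτ using Submodule.span_induction with
  | mem t ht =>
    obtain ⟨y, rfl⟩ := ht
    induction hφ using Submodule.span_induction with
    | mem f hf =>
      obtain ⟨ψ, rfl⟩ := hf
      exact key y ψ
    | zero => simp [epair]
    | add a b _ _ ha hb =>
      simp only [epair, map_add, unop_add, LinearMap.add_apply] at ha hb ⊢
      linear_combination ha + hb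
    | smul r a _ ha =>
      simp only [epair, map_smul, unop_smul, LinearMap.smul_apply, smul_eq_mul] at ha ⊢
      linear_combination r * ha
  | zero => simp [epair]
  | add a b _ _ ha hb =>
    simp only [epair, map_add, unop_add, LinearMap.add_apply] at ha hb ⊢
    linear_combination ha + hb
  | smul r a _ ha =>
    simp only [epair, map_smul, unop_smul, LinearMap.smul_apply, smul_eq_mul] at ha ⊢
    linear_combination r * ha
end
end

section
/- Let g, g* be dual finite-dimensional vector spaces, τ ∈ ∧³g, and d_A: ∧•g* → ∧^{•+1}g* a linear map. For ξ, η ∈ g*, define L(ξ,η): g* → g* by L(ξ,η)(χ) = ι_{τ(η,χ)}(d_A ξ) + ι_{τ(χ,ξ)}(d_A η), where τ(η,χ) := ι_χι_ητ ∈ g. Then trace(L(ξ,η)) = −2⟨d_A(ξ) | ι_ητ⟩ + 2⟨d_A(η) | ι_ξτ⟩. -/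
set_option synthInstance.maxHeartbeats 1000000
set_option maxHeartbeats 1000000

noncomputable section

open ExteriorAlgebra Module MulOpposite

variable {R : Type*} {M W : Type*} [CommRing R] [AddCommGroup M] [Module R M]
  [AddCommGroup W] [Module R W]

variable (R M)

variable {R M}

namespace Stmt11

open ExteriorAlgebra Module

variable (g : Type*) [AddCommGroup g] [Module ℝ g]

/-- Contraction, bundled as a bilinear map. -/
noncomputable def ctrL : Module.Dual ℝ g →ₗ[ℝ]
    ExteriorAlgebra ℝ g →ₗ[ℝ] ExteriorAlgebra ℝ g :=
  CliffordAlgebra.contractLeft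

/-- Contraction on the exterior algebra of the dual space, bundled. -/
noncomputable def ctrLD : Module.Dual ℝ (Module.Dual ℝ g) →ₗ[ℝ]
    ExteriorAlgebra ℝ (Module.Dual ℝ g) →ₗ[ℝ] ExteriorAlgebra ℝ (Module.Dual ℝ g) :=
  CliffordAlgebra.contractLeft

/-- The map `χ ↦ ι_{ι_χ σ} ω`. -/
def Tmap (ω : ExteriorAlgebra ℝ (Module.Dual ℝ g)) (σ : ExteriorAlgebra ℝ g) :
    Module.Dual ℝ g →ₗ[ℝ] Module.Dual ℝ g :=
  ιInv ∘ₗ ((ctrLD g).flip ω) ∘ₗ (Module.Dual.eval ℝ g) ∘ₗ ιInv ∘ₗ ((ctrL g).flip σ)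

theorem ctr_ι_mul (ξ : Module.Dual ℝ g) (x : g) (y : ExteriorAlgebra ℝ g) :
    ctr ξ (ι ℝ x * y) = ξ x • y - ι ℝ x * ctr ξ y :=
  CliffordAlgebra.contractLeft_ι_mul (Q := (0 : QuadraticForm ℝ g)) ξ x y

theorem ctr_ι (ξ : Module.Dual ℝ g) (x : g) :
    ctr ξ (ι ℝ x) = algebraMap ℝ _ (ξ x) :=
  CliffordAlgebra.contractLeft_ι (Q := (0 : QuadraticForm ℝ g)) ξ x

theorem ctr_comm (ξ χ : Module.Dual ℝ g) (y : ExteriorAlgebra ℝ g) :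
    ctr ξ (ctr χ y) = - ctr χ (ctr ξ y) :=
  CliffordAlgebra.contractLeft_comm (Q := (0 : QuadraticForm ℝ g)) ξ χ y

theorem ctr_two (ξ : Module.Dual ℝ g) (x y : g) :
    ctr ξ (ι ℝ x * ι ℝ y) = ι ℝ (ξ x • y - ξ y • x) := by
  rw [ctr_ι_mul, ctr_ι, map_sub, map_smul, map_smul, ← Algebra.commutes, ← Algebra.smul_def]

theorem mem_two_induction {V : Type*} [AddCommGroup V] [Module ℝ V]
    {P : ExteriorAlgebra ℝ V → Prop} {σ : ExteriorAlgebra ℝ V} (hσ : σ ∈ ⋀[ℝ]^2 V)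
    (h1 : ∀ x y : V, P (ι ℝ x * ι ℝ y)) (h2 : ∀ a b, P a → P b → P (a + b)) : P σ := by
  change σ ∈ (LinearMap.range (ι ℝ)) ^ 2 at hσ
  rw [pow_two] at hσ
  refine Submodule.mul_induction_on hσ ?_ h2
  rintro _ ⟨x, rfl⟩ _ ⟨y, rfl⟩
  exact h1 x y

theorem ctr_mem (ξ : Module.Dual ℝ g) {τ : ExteriorAlgebra ℝ g} (hτ : τ ∈ ⋀[ℝ]^3 g) :
    ctr ξ τ ∈ ⋀[ℝ]^2 g := by
  change τ ∈ (LinearMap.range (ι ℝ)) ^ 3 at hτ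
  rw [pow_succ'] at hτ
  refine Submodule.mul_induction_on hτ ?_ ?_
  · rintro _ ⟨x, rfl⟩ b hb
    rw [ctr_ι_mul]
    refine Submodule.sub_mem _ (Submodule.smul_mem _ _ hb) ?_
    refine mem_two_induction (P := fun b => ι ℝ x * ctr ξ b ∈ ⋀[ℝ]^2 g) hb ?_ ?_
    · intro u v
      rw [ctr_two]
      change _ ∈ (LinearMap.range (ι ℝ)) ^ 2
      rw [pow_two]
      exact Submodule.mul_mem_mul ⟨_, rfl⟩ ⟨_, rfl⟩
    · intro a b ha hb
      rw [map_add, mul_add]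
      exact Submodule.add_mem _ ha hb
  · intro a b ha hb
    rw [map_add]
    exact Submodule.add_mem _ ha hb

theorem ιInv_ι {V : Type*} [AddCommGroup V] [Module ℝ V] (v : V) : ιInv (ι ℝ v) = v :=
  ι_leftInverse v

theorem Tmap_apply (a b : Module.Dual ℝ g) (x y : g) (χ : Module.Dual ℝ g) :
    Tmap g (ι ℝ a * ι ℝ b) (ι ℝ x * ι ℝ y) χ =
      (χ x * a y - χ y * a x) • b - (χ x * b y - χ y * b x) • a := by
  have h1 : (ctrL g).flip (ι ℝ x * ι ℝ y) χ = ι ℝ (χ x • y - χ y • x) := ctr_two g χ x y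
  have h2 (v : g) : (ctrLD g).flip (ι ℝ a * ι ℝ b) (Module.Dual.eval ℝ g v)
      = ι ℝ (a v • b - b v • a) := ctr_two _ (Module.Dual.eval ℝ g v) a b
  simp only [Tmap, LinearMap.comp_apply, h1, h2, ιInv_ι]
  simp

theorem epair_two (a b : Module.Dual ℝ g) (x y : g) :
    epair (ι ℝ a * ι ℝ b) (ι ℝ x * ι ℝ y) = a x * b y - a y * b x := by
  have h (c : Module.Dual ℝ g) : mctrF ℝ g (ι ℝ c) = MulOpposite.op (ctr c) := by
    simp only [mctrF, mctrAux, lift_ι_apply]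
    rfl
  rw [epair, map_mul (mctrF ℝ g), h, h]
  change algebraMapInv (ctr b (ctr a _)) = _
  rw [ctr_two, ctr_ι, algebraMap_leftInverse g]
  simp

theorem trace_rank_one [FiniteDimensional ℝ g] (x : g) (a : Module.Dual ℝ g) :
    LinearMap.trace ℝ (Module.Dual ℝ g) ((Module.Dual.eval ℝ g x).smulRight a) = a x := by
  simp [LinearMap.trace_smulRight]

theorem trace_Tmap [FiniteDimensional ℝ g] {ω : ExteriorAlgebra ℝ (Module.Dual ℝ g)}
    {σ : ExteriorAlgebra ℝ g} (hω : ω ∈ ⋀[ℝ]^2 (Module.Dual ℝ g)) (hσ : σ ∈ ⋀[ℝ]^2 g) :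
    LinearMap.trace ℝ (Module.Dual ℝ g) (Tmap g ω σ) = -2 * epair ω σ := by
  refine mem_two_induction (P := fun ω => LinearMap.trace ℝ (Module.Dual ℝ g) (Tmap g ω σ) =
    -2 * epair ω σ) hω ?_ ?_
  · intro a b
    refine mem_two_induction (P := fun σ => LinearMap.trace ℝ (Module.Dual ℝ g)
      (Tmap g (ι ℝ a * ι ℝ b) σ) = -2 * epair (ι ℝ a * ι ℝ b) σ) hσ ?_ ?_
    · intro x y
      have : Tmap g (ι ℝ a * ι ℝ b) (ι ℝ x * ι ℝ y) =
          a y • (Module.Dual.eval ℝ g x).smulRight b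
          + (-a x) • (Module.Dual.eval ℝ g y).smulRight b
          + (-b y) • (Module.Dual.eval ℝ g x).smulRight a
          + b x • (Module.Dual.eval ℝ g y).smulRight a := by
        apply LinearMap.ext
        intro χ
        rw [Tmap_apply]
        simp only [LinearMap.add_apply, LinearMap.smul_apply, LinearMap.smulRight_apply,
          Module.Dual.eval_apply]
        module
      rw [this, epair_two]
      simp only [map_add, map_smul, trace_rank_one, smul_eq_mul]
      ring
    · intro s t hs ht
      have e : Tmap g (ι ℝ a * ι ℝ b) (s + t) =
          Tmap g (ι ℝ a * ι ℝ b) s + Tmap g (ι ℝ a * ι ℝ b) t := by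
        simp only [Tmap, map_add, LinearMap.comp_add, LinearMap.add_comp]
      rw [e, map_add, hs, ht]
      simp only [epair, map_add]
      ring
  · intro s t hs ht
    have e : Tmap g (s + t) σ = Tmap g s σ + Tmap g t σ := by
      simp only [Tmap, map_add, LinearMap.comp_add, LinearMap.add_comp]
    rw [e, map_add, hs, ht]
    simp only [epair, map_add, MulOpposite.unop_add, LinearMap.add_apply]
    ring

/-- Let `g`, `g*` be dual finite-dimensional vector spaces,
`τ ∈ ∧³g`, and `d_A : ∧•g* → ∧^{•+1}g*` a linear map.  For `ξ, η ∈ g*`, define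
`L(ξ,η) : g* → g*` by `L(ξ,η)(χ) = ι_{τ(η,χ)}(d_A ξ) + ι_{τ(χ,ξ)}(d_A η)`, where
`τ(η,χ) := ι_χι_ητ ∈ g`.  Then
`trace(L(ξ,η)) = −2⟨d_A(ξ) | ι_ητ⟩ + 2⟨d_A(η) | ι_ξτ⟩`. -/
theorem trace_L
    [FiniteDimensional ℝ g]
    (dA : Module.Dual ℝ g →ₗ[ℝ] ExteriorAlgebra ℝ (Module.Dual ℝ g))
    (hdA : ∀ ξ, dA ξ ∈ ⋀[ℝ]^2 (Module.Dual ℝ g))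
    (τ : ExteriorAlgebra ℝ g) (hτ : τ ∈ ⋀[ℝ]^3 g)
    (ξ η : Module.Dual ℝ g)
    (L : Module.Dual ℝ g →ₗ[ℝ] Module.Dual ℝ g)
    (hL : L =
      -- χ ↦ ι_{τ(η,χ)}(d_A ξ),  with τ(η,χ) = ι_χ(ι_η τ)
      ιInv ∘ₗ ((ctrLD g).flip (dA ξ)) ∘ₗ (Module.Dual.eval ℝ g) ∘ₗ
        ιInv ∘ₗ ((ctrL g).flip (ctr η τ))
      +
      -- χ ↦ ι_{τ(χ,ξ)}(d_A η),  with τ(χ,ξ) = ι_ξ(ι_χ τ)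
      ιInv ∘ₗ ((ctrLD g).flip (dA η)) ∘ₗ (Module.Dual.eval ℝ g) ∘ₗ
        ιInv ∘ₗ (ctr ξ) ∘ₗ ((ctrL g).flip τ)) :
    LinearMap.trace ℝ (Module.Dual ℝ g) L =
      -2 * epair (dA ξ) (ctr η τ) + 2 * epair (dA η) (ctr ξ τ) := by
  have e : L = Tmap g (dA ξ) (ctr η τ) + (-1 : ℝ) • Tmap g (dA η) (ctr ξ τ) := by
    rw [hL]
    congr 1
    apply LinearMap.ext
    intro χ
    have h : ctr ξ ((ctrL g).flip τ χ) = (-1 : ℝ) • ((ctrL g).flip (ctr ξ τ) χ) := by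
      rw [neg_one_smul]
      exact ctr_comm g ξ χ τ
    simp only [Tmap, LinearMap.smul_apply, LinearMap.comp_apply, h, map_smul]
  rw [e, map_add, map_smul, smul_eq_mul, trace_Tmap g (hdA ξ) (ctr_mem g η hτ), trace_Tmap g (hdA η) (ctr_mem g ξ hτ)]
  ring

end Stmt11
end
end

section
/- Let g, g* be dual finite-dimensional vector spaces with τ ∈ ∧³g and φ ∈ ∧³g*. On ∧•g, the anticommutator of wedge-multiplication by τ and contraction by φ satisfies: (τ∧ ι_φ + ι_φ ∘ τ∧)(v) = ⟨τ|φ⟩ v − Q₁(v) − Q₂(v) for all v ∈ ∧•g, where Q₁ and Q₂ are the explicit second- and first-order contraction operators defined from the decompositions of τ and φ. -/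
set_option synthInstance.maxHeartbeats 1000000
set_option maxHeartbeats 1000000

noncomputable section

open ExteriorAlgebra Module MulOpposite

variable {R : Type*} {M W : Type*} [CommRing R] [AddCommGroup M] [Module R M]
  [AddCommGroup W] [Module R W]

variable (R M)

variable {R M}

theorem ctr_graded {g : Type*} [AddCommGroup g] [Module ℝ g] (ξ : Module.Dual ℝ g) (n : ℕ) :
    ∀ x ∈ (LinearMap.range (ι ℝ : g →ₗ[ℝ] ExteriorAlgebra ℝ g)) ^ n,
      ∀ v, ctr ξ (x * v) = ctr ξ x * v + (-1 : ℝ) ^ n • (x * ctr ξ v) := by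
  induction n with
  | zero =>
    intro x hx v
    rw [pow_zero, Submodule.mem_one] at hx
    obtain ⟨r, rfl⟩ := hx
    have h1 : ctr ξ (algebraMap ℝ (ExteriorAlgebra ℝ g) r) = 0 :=
      CliffordAlgebra.contractLeft_algebraMap (Q := (0 : QuadraticForm ℝ g)) ξ r
    rw [h1, ← Algebra.smul_def, ← Algebra.smul_def, map_smul]
    simp
  | succ n ih =>
    intro x hx v
    rw [pow_succ'] at hx
    induction hx using Submodule.mul_induction_on' with
    | mem_mul_mem m hm y hy =>
      obtain ⟨a, rfl⟩ := hm
      have key : ∀ w, ctr ξ (ι ℝ a * w) = ξ a • w - ι ℝ a * ctr ξ w := fun w =>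
        CliffordAlgebra.contractLeft_ι_mul (Q := (0 : QuadraticForm ℝ g)) (d := ξ) a w
      rw [mul_assoc, key, key, ih y hy v, pow_succ]
      simp only [mul_add, sub_mul, mul_assoc, smul_mul_assoc, mul_smul_comm, mul_neg, mul_one,
        neg_smul]
      abel
    | add x hx y hy h1 h2 =>
      rw [add_mul, map_add, map_add, h1, h2, add_mul, add_mul, smul_add]
      abel

theorem ctr_mem {g : Type*} [AddCommGroup g] [Module ℝ g] (ξ : Module.Dual ℝ g) (n : ℕ) :
    ∀ x ∈ (LinearMap.range (ι ℝ : g →ₗ[ℝ] ExteriorAlgebra ℝ g)) ^ (n + 1),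
      ctr ξ x ∈ (LinearMap.range (ι ℝ : g →ₗ[ℝ] ExteriorAlgebra ℝ g)) ^ n := by
  have key : ∀ a w, ctr ξ (ι ℝ a * w) = ξ a • w - ι ℝ a * ctr ξ w := fun a w =>
    CliffordAlgebra.contractLeft_ι_mul (Q := (0 : QuadraticForm ℝ g)) (d := ξ) a w
  induction n with
  | zero =>
    intro x hx
    rw [zero_add, pow_one] at hx
    obtain ⟨a, rfl⟩ := hx
    have h1 : ctr ξ (ι ℝ a) = algebraMap ℝ (ExteriorAlgebra ℝ g) (ξ a) :=
      CliffordAlgebra.contractLeft_ι (Q := (0 : QuadraticForm ℝ g)) ξ a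
    rw [h1, pow_zero, Submodule.mem_one]
    exact ⟨_, rfl⟩
  | succ n ih =>
    intro x hx
    rw [pow_succ'] at hx
    induction hx using Submodule.mul_induction_on' with
    | mem_mul_mem m hm y hy =>
      obtain ⟨a, rfl⟩ := hm
      rw [key]
      refine Submodule.sub_mem _ (Submodule.smul_mem _ _ hy) ?_
      rw [pow_succ']
      exact Submodule.mul_mem_mul ⟨a, rfl⟩ (ih y hy)
    | add x hx y hy h1 h2 =>
      rw [map_add]
      exact Submodule.add_mem _ h1 h2

theorem mctrF_ι {g : Type*} [AddCommGroup g] [Module ℝ g] (ξ : Module.Dual ℝ g) :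
    mctrF ℝ g (ι ℝ ξ) = MulOpposite.op (ctr ξ) := by
  unfold mctrF mctrAux
  rw [ExteriorAlgebra.lift_ι_apply]
  rfl

theorem mctrF_apply {g : Type*} [AddCommGroup g] [Module ℝ g] {κ : Type*} [Fintype κ]
    (p1 p2 p3 : κ → Module.Dual ℝ g) (v : ExteriorAlgebra ℝ g) :
    (mctrF ℝ g (∑ j, ι ℝ (p1 j) * ι ℝ (p2 j) * ι ℝ (p3 j))).unop v
      = ∑ j, ctr (p3 j) (ctr (p2 j) (ctr (p1 j) v)) := by
  simp only [map_sum, map_mul, mctrF_ι, Finset.unop_sum, LinearMap.sum_apply,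
    MulOpposite.unop_mul, MulOpposite.unop_op, Module.End.mul_apply]

open ExteriorAlgebra Module Finset in
/-- Let `g`, `g*` be dual finite-dimensional vector spaces with
`τ ∈ ∧³g` and `φ = Σⱼ φ_{j1}∧φ_{j2}∧φ_{j3} ∈ ∧³g*`.  On `∧•g`, the anticommutator of
wedge-multiplication by `τ` and contraction by `φ` satisfies
`(τ∧ ι_φ + ι_φ ∘ τ∧)(v) = ⟨τ|φ⟩ v − Q₁(v) − Q₂(v)`, where
`Q₁ = Σⱼ ((ι_{φj3}ι_{φj2}τ)∧ι_{φj1} − (ι_{φj3}ι_{φj1}τ)∧ι_{φj2} + (ι_{φj2}ι_{φj1}τ)∧ι_{φj3})`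
and
`Q₂ = Σⱼ (−(ι_{φj3}τ)∧ι_{φj2}ι_{φj1} + (ι_{φj2}τ)∧ι_{φj3}ι_{φj1} − (ι_{φj1}τ)∧ι_{φj3}ι_{φj2})`. -/
theorem wedge_tau_contract_phi_anticommutator
    (g : Type*) [AddCommGroup g] [Module ℝ g] [FiniteDimensional ℝ g]
    (τ : ExteriorAlgebra ℝ g) (hτ : τ ∈ ⋀[ℝ]^3 g)
    (κ : Type*) [Fintype κ]
    (p1 p2 p3 : κ → Module.Dual ℝ g)
    (φ : ExteriorAlgebra ℝ (Module.Dual ℝ g))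
    (hφ : φ = ∑ j, ι ℝ (p1 j) * ι ℝ (p2 j) * ι ℝ (p3 j))
    (Q1 Q2 : Module.End ℝ (ExteriorAlgebra ℝ g))
    (hQ1 : Q1 = ∑ j,
      ((LinearMap.mulLeft ℝ (ctr (p3 j) (ctr (p2 j) τ))) ∘ₗ ctr (p1 j)
      - (LinearMap.mulLeft ℝ (ctr (p3 j) (ctr (p1 j) τ))) ∘ₗ ctr (p2 j)
      + (LinearMap.mulLeft ℝ (ctr (p2 j) (ctr (p1 j) τ))) ∘ₗ ctr (p3 j)))
    (hQ2 : Q2 = ∑ j,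
      (- (LinearMap.mulLeft ℝ (ctr (p3 j) τ)) ∘ₗ (ctr (p2 j) ∘ₗ ctr (p1 j))
      + (LinearMap.mulLeft ℝ (ctr (p2 j) τ)) ∘ₗ (ctr (p3 j) ∘ₗ ctr (p1 j))
      - (LinearMap.mulLeft ℝ (ctr (p1 j) τ)) ∘ₗ (ctr (p3 j) ∘ₗ ctr (p2 j)))) :
    ∀ v : ExteriorAlgebra ℝ g,
      τ * ((mctrF ℝ g φ).unop v) + (mctrF ℝ g φ).unop (τ * v)
        = epair φ τ • v - Q1 v - Q2 v := by
  intro v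
  subst hφ hQ1 hQ2
  have hτ' : τ ∈ (LinearMap.range (ι ℝ : g →ₗ[ℝ] ExteriorAlgebra ℝ g)) ^ 3 := hτ
  have hsc : epair (∑ j, ι ℝ (p1 j) * ι ℝ (p2 j) * ι ℝ (p3 j)) τ • v
      = ∑ j, ctr (p3 j) (ctr (p2 j) (ctr (p1 j) τ)) * v := by
    unfold epair
    rw [mctrF_apply, map_sum, Finset.sum_smul]
    refine Finset.sum_congr rfl fun j _ => ?_
    have h := ctr_mem (p3 j) 0 _ (ctr_mem (p2 j) 1 _ (ctr_mem (p1 j) 2 _ hτ'))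
    rw [pow_zero, Submodule.mem_one] at h
    obtain ⟨r, hr⟩ := h
    rw [← hr, ExteriorAlgebra.algebraMap_leftInverse g r, Algebra.smul_def]
  rw [hsc, mctrF_apply, mctrF_apply, Finset.mul_sum, LinearMap.sum_apply, LinearMap.sum_apply,
    ← Finset.sum_add_distrib, ← Finset.sum_sub_distrib, ← Finset.sum_sub_distrib]
  refine Finset.sum_congr rfl fun j _ => ?_
  have m1 := ctr_mem (p1 j) 2 _ hτ'
  have m2 := ctr_mem (p2 j) 2 _ hτ'
  have m21 := ctr_mem (p2 j) 1 _ m1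
  simp only [LinearMap.add_apply, LinearMap.sub_apply, LinearMap.neg_apply, LinearMap.comp_apply,
    LinearMap.mulLeft_apply, LinearMap.neg_comp]
  rw [ctr_graded (p1 j) 3 τ hτ', map_add, map_smul, ctr_graded (p2 j) 2 _ m1,
    ctr_graded (p2 j) 3 τ hτ']
  simp only [map_add, map_smul]
  rw [ctr_graded (p3 j) 1 _ m21, ctr_graded (p3 j) 2 _ m1, ctr_graded (p3 j) 2 _ m2,
    ctr_graded (p3 j) 3 τ hτ']
  module
end
end
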